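/- Mean square stability of the stochastic theta method for nonlinear SDEs driven by fBm, large θ: Assume H ∈ (1/2,1), Δt > 0, κ ≥ 2H, λ > 0, λ̄ ≥ λ and μ > 0, with λ, μ satisfying Condition (C). Let f, g : (0,∞) × ℝ → ℝ satisfy the monotone condition x·f(t,x) ≤ −λκ t^{κ−1} x², the linear growth condition |f(t,x)| ≤ λ̄κ t^{κ−1} |x|, and the uniform linear growth condition |g(t,x)| ≤ μ|x| for all t > 0 and x ∈ ℝ. Let θ satisfy (√6·e·(λ̄/λ))/(√6·e·(λ̄/λ) + 1) ≤ θ < 1. Let (V_n)_{n≥0} be a sequence of fBm increments with Hurst parameter H and step Δt, set t_n = n·Δt, let X_0 be a nonzero real constant, and let (X_n)_{n≥0} be real random variables satisfying almost surely X_{n+1} = X_n + θ·f(t_{n+1},X_{n+1})·Δt + (1−θ)·f(t_n,X_n)·Δt + g(t_n,X_n)·V_n for every n ≥ 0. Then lim_{n→∞} E[X_n²] = 0. -/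

import Mathlib

open MeasureTheory ProbabilityTheory Filter Real

/-- Covariance of the increments of a fractional Brownian motion with Hurst
parameter `H` over a grid of step `Δt`. -/
noncomputable def fBmCov (H Δt : ℝ) (i j : ℕ) : ℝ :=
  Δt ^ (2 * H) / 2 *
    (|(i : ℝ) - j + 1| ^ (2 * H) + |(i : ℝ) - j - 1| ^ (2 * H)
      - 2 * |(i : ℝ) - j| ^ (2 * H))

/-- `(V n)` is a sequence of fBm increments with Hurst parameter `H` and step `Δt`:
each finite initial segment is a centered Gaussian vector with the fBm increment
covariances, expressed by the fact that every linear combination is a centered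
real Gaussian with the corresponding variance. -/
def IsfBmIncrements {Ω : Type*} [MeasurableSpace Ω] (P : Measure Ω) (H Δt : ℝ)
    (V : ℕ → Ω → ℝ) : Prop :=
  (∀ n, Measurable (V n)) ∧
    ∀ (n : ℕ) (c : ℕ → ℝ),
      P.map (fun ω => ∑ i ∈ Finset.range n, c i * V i ω)
        = gaussianReal 0
            (Real.toNNReal (∑ i ∈ Finset.range n, ∑ j ∈ Finset.range n,
              c i * c j * fBmCov H Δt i j))

/-! ### Covariances of fractional Brownian increments -/

theorem fBmCov_comm (H Δt : ℝ) (i j : ℕ) : fBmCov H Δt i j = fBmCov H Δt j i := by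
  unfold fBmCov
  rw [abs_sub_comm (i : ℝ) j, ← abs_neg ((i : ℝ) - j + 1), ← abs_neg ((i : ℝ) - j - 1)]
  ring_nf

theorem fBmCov_nonneg {H Δt : ℝ} (hH : 1 / 2 ≤ H) (hΔt : 0 ≤ Δt) (i j : ℕ) :
    0 ≤ fBmCov H Δt i j := by
  unfold fBmCov
  refine mul_nonneg (by positivity) ?_
  generalize (i : ℝ) - j = m
  have habs : |m| ≤ (1 / 2 : ℝ) * |m + 1| + (1 / 2 : ℝ) * |m - 1| := by
    have h := abs_add_le (m + 1) (m - 1)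
    rw [show m + 1 + (m - 1) = 2 * m by ring, abs_mul, abs_two] at h
    linarith
  have hmono := rpow_le_rpow (abs_nonneg m) habs (by linarith : 0 ≤ 2 * H)
  have hconv := (convexOn_rpow (by linarith : 1 ≤ 2 * H)).2
    (Set.mem_Ici.2 (abs_nonneg (m + 1))) (Set.mem_Ici.2 (abs_nonneg (m - 1)))
    (by norm_num : (0 : ℝ) ≤ 1 / 2) (by norm_num : (0 : ℝ) ≤ 1 / 2) (by norm_num)
  simp only [smul_eq_mul] at hconv
  linarith

theorem add_one_rpow_sub_rpow_le {p x : ℝ} (hp : 1 ≤ p) (hx : 0 ≤ x) :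
    (x + 1) ^ p - x ^ p ≤ p * (x + 1) ^ (p - 1) := by
  have hx1 : 0 < x + 1 := by linarith
  have hb := one_add_mul_self_le_rpow_one_add (s := -(1 / (x + 1)))
    (by rw [neg_le_neg_iff, div_le_one hx1]; linarith) hp
  have he : 1 + -(1 / (x + 1)) = x / (x + 1) := by field_simp; ring
  rw [he, div_rpow hx hx1.le, le_div_iff₀ (rpow_pos_of_pos hx1 p)] at hb
  rw [rpow_sub_one hx1.ne']
  have : (1 + p * -(1 / (x + 1))) * (x + 1) ^ p
    = (x + 1) ^ p - p * ((x + 1) ^ p / (x + 1)) := by field_simp; ring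
  linarith

theorem sum_fBmCov_le {H Δt : ℝ} (hH : 1 / 2 ≤ H) (hH1 : H ≤ 1) (hΔt : 0 ≤ Δt)
    {n j : ℕ} (hj : j < n) :
    ∑ k ∈ Finset.range n, fBmCov H Δt j k ≤ 2 * Δt ^ (2 * H) * (n : ℝ) ^ (2 * H - 1) := by
  have hjn : (j : ℝ) + 1 ≤ n := by exact_mod_cast hj
  have hj0 : (0 : ℝ) ≤ j := j.cast_nonneg
  have bound : ∀ x : ℝ, 0 ≤ x → x + 1 ≤ n →
      (x + 1) ^ (2 * H) - x ^ (2 * H) ≤ 2 * (n : ℝ) ^ (2 * H - 1) := fun x hx hxn => by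
    have hle := rpow_le_rpow (by linarith) hxn (by linarith : 0 ≤ 2 * H - 1)
    have hnn : 0 ≤ (x + 1) ^ (2 * H - 1) := by positivity
    have := add_one_rpow_sub_rpow_le (by linarith : 1 ≤ 2 * H) hx
    nlinarith
  have htel := Finset.sum_range_sub'
    (fun k : ℕ => |(j : ℝ) - k + 1| ^ (2 * H) - |(j : ℝ) - k| ^ (2 * H)) n
  have hsum : ∑ k ∈ Finset.range n, fBmCov H Δt j k = Δt ^ (2 * H) / 2 *
      ((|(j : ℝ) + 1| ^ (2 * H) - |(j : ℝ)| ^ (2 * H))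
        - (|(j : ℝ) - n + 1| ^ (2 * H) - |(j : ℝ) - n| ^ (2 * H))) := by
    simp only [Nat.cast_zero, sub_zero] at htel
    rw [← htel, Finset.mul_sum]
    refine Finset.sum_congr rfl fun k _ => ?_
    unfold fBmCov
    push_cast
    rw [show (j : ℝ) - (k + 1) + 1 = j - k by ring,
      show (j : ℝ) - (k + 1) = j - k - 1 by ring]
    ring
  rw [hsum, abs_of_nonneg hj0, abs_of_nonneg (by linarith : 0 ≤ (j : ℝ) + 1),
    abs_of_nonpos (by linarith : (j : ℝ) - n + 1 ≤ 0),
    abs_of_nonpos (by linarith : (j : ℝ) - n ≤ 0)]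
  have h1 := bound j hj0 hjn
  have h2 := bound (n - j - 1) (by linarith) (by linarith)
  rw [show (n : ℝ) - j - 1 + 1 = -(j - n) by ring,
    show (n : ℝ) - j - 1 = -(j - n + 1) by ring] at h2
  have hD : 0 ≤ Δt ^ (2 * H) / 2 := by positivity
  nlinarith

/-- Variance bound for weighted sums of increments with weights decaying like `k ^ (1 - 2 * H)`;
the growth is strictly slower than linear. -/
theorem exists_weighted_fBmCov_sum_le {H Δt : ℝ} (hH : H ∈ Set.Ioo (1 / 2 : ℝ) 1) (hΔt : 0 ≤ Δt)
    {β : ℕ → ℝ} {B : ℝ} (hβ0 : ∀ k, 0 ≤ β k)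
    (hβ : ∀ k : ℕ, β k ≤ B * ((k : ℝ) + 1) ^ (-(2 * H - 1))) :
    ∃ K η : ℝ, 0 < η ∧ η < 1 ∧ ∀ n : ℕ,
      ∑ i ∈ Finset.range n, ∑ j ∈ Finset.range n, β i * β j * fBmCov H Δt i j
        ≤ K * (n : ℝ) ^ (1 - η) := by
  obtain ⟨hH0, hH1⟩ := hH
  set a := 2 * H - 1 with ha
  have ha0 : 0 < a := by linarith
  have ha1 : a < 1 := by linarith
  set η := a * (1 - a) with hη
  have hη0 : 0 < η := mul_pos ha0 (by linarith)
  have hηa : η < a := by nlinarith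
  have hη1 : η ≤ 1 - a := by nlinarith
  have hsum : Summable fun k : ℕ => ((k : ℝ) + 1) ^ (-1 - a + η) := by
    have h := (summable_nat_add_iff 1).2
      (Real.summable_nat_rpow (p := -1 - a + η) |>.2 (by linarith))
    simpa using h
  set S := ∑' k : ℕ, ((k : ℝ) + 1) ^ (-1 - a + η)
  refine ⟨2 * Δt ^ (2 * H) * B ^ 2 * S, η, hη0, by linarith, fun n => ?_⟩
  have hcov := fun i j => fBmCov_nonneg (Δt := Δt) hH0.le hΔt i j
  calc ∑ i ∈ Finset.range n, ∑ j ∈ Finset.range n, β i * β j * fBmCov H Δt i j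
      ≤ ∑ i ∈ Finset.range n, ∑ j ∈ Finset.range n,
          (β i ^ 2 / 2 * fBmCov H Δt i j + β j ^ 2 / 2 * fBmCov H Δt i j) := by
        refine Finset.sum_le_sum fun i _ => Finset.sum_le_sum fun j _ => ?_
        rw [← add_mul]
        exact mul_le_mul_of_nonneg_right (by nlinarith [sq_nonneg (β i - β j)]) (hcov i j)
    _ = ∑ i ∈ Finset.range n, β i ^ 2 * ∑ j ∈ Finset.range n, fBmCov H Δt i j := by
        simp only [Finset.sum_add_distrib]
        rw [Finset.sum_comm (f := fun i j => β j ^ 2 / 2 * fBmCov H Δt i j),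
          ← Finset.sum_add_distrib]
        refine Finset.sum_congr rfl fun i _ => ?_
        rw [← Finset.sum_add_distrib, Finset.mul_sum]
        refine Finset.sum_congr rfl fun j _ => ?_
        rw [fBmCov_comm H Δt j i]
        ring
    _ ≤ ∑ i ∈ Finset.range n, 2 * Δt ^ (2 * H) * B ^ 2 * (n : ℝ) ^ (1 - η)
          * ((i : ℝ) + 1) ^ (-1 - a + η) := by
        refine Finset.sum_le_sum fun i hi => ?_
        have hin := Finset.mem_range.1 hi
        have hin' : (i : ℝ) + 1 ≤ n := by exact_mod_cast hin
        have hi0 : (0 : ℝ) < (i : ℝ) + 1 := by positivity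
        have hn0 : (0 : ℝ) < n := by linarith
        have h1 : β i ^ 2 ≤ B ^ 2 * ((i : ℝ) + 1) ^ (-2 * a) := by
          have h := pow_le_pow_left₀ (hβ0 i) (hβ i) 2
          rwa [mul_pow, ← rpow_mul_natCast hi0.le,
            show -a * ((2 : ℕ) : ℝ) = -2 * a by push_cast; ring] at h
        have h2 := sum_fBmCov_le (Δt := Δt) hH0.le hH1.le hΔt hin
        have h3 : (n : ℝ) ^ a ≤ (n : ℝ) ^ (1 - η) * ((i : ℝ) + 1) ^ (a - 1 + η) := by
          calc (n : ℝ) ^ a = (n : ℝ) ^ (1 - η) * (n : ℝ) ^ (a - 1 + η) := by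
                rw [← rpow_add hn0, show 1 - η + (a - 1 + η) = a by ring]
            _ ≤ _ := by
                gcongr ?_ * ?_
                exact rpow_le_rpow_of_nonpos hi0 hin' (by linarith)
        calc β i ^ 2 * ∑ j ∈ Finset.range n, fBmCov H Δt i j
            ≤ (B ^ 2 * ((i : ℝ) + 1) ^ (-2 * a)) * (2 * Δt ^ (2 * H) *
                ((n : ℝ) ^ (1 - η) * ((i : ℝ) + 1) ^ (a - 1 + η))) := by
              refine mul_le_mul h1 (h2.trans ?_) (Finset.sum_nonneg fun j _ => hcov i j)
                (by positivity)
              gcongr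
          _ = 2 * Δt ^ (2 * H) * B ^ 2 * (n : ℝ) ^ (1 - η)
                * (((i : ℝ) + 1) ^ (-2 * a) * ((i : ℝ) + 1) ^ (a - 1 + η)) := by ring
          _ = _ := by
              rw [← rpow_add hi0, show -2 * a + (a - 1 + η) = -1 - a + η by ring]
    _ = 2 * Δt ^ (2 * H) * B ^ 2 * (n : ℝ) ^ (1 - η)
          * ∑ i ∈ Finset.range n, ((i : ℝ) + 1) ^ (-1 - a + η) := by rw [Finset.mul_sum]
    _ ≤ 2 * Δt ^ (2 * H) * B ^ 2 * (n : ℝ) ^ (1 - η) * S := by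
        gcongr
        exact hsum.sum_le_tsum _ fun k _ => by positivity
    _ = _ := by ring

/-! ### Exponential moments -/

theorem prod_exp_abs_le_sum_powerset (x : ℕ → ℝ) (n : ℕ) :
    ∏ k ∈ Finset.range n, exp |x k| ≤ ∑ s ∈ (Finset.range n).powerset,
      exp (∑ k ∈ Finset.range n, (if k ∈ s then 1 else -1) * x k) := by
  calc ∏ k ∈ Finset.range n, exp |x k|
      ≤ ∏ k ∈ Finset.range n, (exp (x k) + exp (-x k)) := by
        refine Finset.prod_le_prod (fun _ _ => (exp_pos _).le) fun k _ => ?_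
        rcases abs_choice (x k) with h | h <;> rw [h] <;>
          linarith [exp_pos (x k), exp_pos (-x k)]
    _ = _ := by
        rw [Finset.prod_add]
        refine Finset.sum_congr rfl fun s hs => ?_
        rw [← Finset.sum_sdiff (Finset.mem_powerset.1 hs), exp_add, exp_sum, exp_sum, mul_comm]
        congr 1
        · refine Finset.prod_congr rfl fun k hk => ?_
          rw [if_neg (Finset.mem_sdiff.1 hk).2, neg_one_mul]
        · refine Finset.prod_congr rfl fun k hk => ?_
          rw [if_pos hk, one_mul]

namespace IsfBmIncrements

variable {Ω : Type*} [MeasurableSpace Ω] {P : Measure Ω} {H Δt : ℝ} {V : ℕ → Ω → ℝ}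

theorem measurable_sum (hV : IsfBmIncrements P H Δt V) (n : ℕ) (c : ℕ → ℝ) :
    Measurable fun ω => ∑ i ∈ Finset.range n, c i * V i ω :=
  Finset.measurable_fun_sum _ fun i _ => (hV.1 i).const_mul (c i)

theorem integrable_exp_sum (hV : IsfBmIncrements P H Δt V) (n : ℕ) (c : ℕ → ℝ) :
    Integrable (fun ω => exp (∑ i ∈ Finset.range n, c i * V i ω)) P := by
  have h := integrable_exp_mul_gaussianReal (μ := 0)
    (v := Real.toNNReal (∑ i ∈ Finset.range n, ∑ j ∈ Finset.range n,
      c i * c j * fBmCov H Δt i j)) 1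
  rw [← hV.2 n c] at h
  simpa [Function.comp_def] using h.comp_measurable (hV.measurable_sum n c)

theorem integral_exp_sum (hV : IsfBmIncrements P H Δt V) (n : ℕ) (c : ℕ → ℝ) :
    ∫ ω, exp (∑ i ∈ Finset.range n, c i * V i ω) ∂P =
      exp (Real.toNNReal (∑ i ∈ Finset.range n, ∑ j ∈ Finset.range n,
        c i * c j * fBmCov H Δt i j) / 2) := by
  have h := mgf_gaussianReal (hV.2 n c) 1
  simpa [mgf] using h

theorem integrable_sum_powerset (hV : IsfBmIncrements P H Δt V) (β : ℕ → ℝ) (n : ℕ) :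
    Integrable (fun ω => ∑ s ∈ (Finset.range n).powerset,
      exp (∑ k ∈ Finset.range n, (if k ∈ s then 1 else -1) * (β k * V k ω))) P := by
  refine integrable_finsetSum _ fun s _ => ?_
  simpa only [← mul_assoc] using
    hV.integrable_exp_sum n fun k => (if k ∈ s then 1 else -1) * β k

theorem integrable_prod_exp_abs (hV : IsfBmIncrements P H Δt V) (β : ℕ → ℝ) (n : ℕ) :
    Integrable (fun ω => ∏ k ∈ Finset.range n, exp |β k * V k ω|) P := by
  refine (hV.integrable_sum_powerset β n).mono' ?_ ?_
  · refine Measurable.aestronglyMeasurable (Finset.measurable_fun_prod _ fun k _ => ?_)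
    exact ((hV.1 k).const_mul (β k)).abs.exp
  · refine ae_of_all _ fun ω => ?_
    rw [norm_of_nonneg (Finset.prod_nonneg fun _ _ => (exp_pos _).le)]
    exact prod_exp_abs_le_sum_powerset (fun k => β k * V k ω) n

theorem integral_prod_exp_abs_le (hV : IsfBmIncrements P H Δt V) (hH : 1 / 2 ≤ H) (hΔt : 0 ≤ Δt)
    {β : ℕ → ℝ} (hβ : ∀ k, 0 ≤ β k) (n : ℕ) :
    ∫ ω, ∏ k ∈ Finset.range n, exp |β k * V k ω| ∂P ≤
      2 ^ n * exp ((∑ i ∈ Finset.range n, ∑ j ∈ Finset.range n,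
        β i * β j * fBmCov H Δt i j) / 2) := by
  have hnn : ∀ i j, 0 ≤ β i * β j * fBmCov H Δt i j := fun i j =>
    mul_nonneg (mul_nonneg (hβ i) (hβ j)) (fBmCov_nonneg hH hΔt i j)
  calc ∫ ω, ∏ k ∈ Finset.range n, exp |β k * V k ω| ∂P
      ≤ ∫ ω, ∑ s ∈ (Finset.range n).powerset,
          exp (∑ k ∈ Finset.range n, (if k ∈ s then 1 else -1) * (β k * V k ω)) ∂P :=
        integral_mono (hV.integrable_prod_exp_abs β n) (hV.integrable_sum_powerset β n)
          fun ω => prod_exp_abs_le_sum_powerset (fun k => β k * V k ω) n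
    _ = ∑ s ∈ (Finset.range n).powerset, ∫ ω,
          exp (∑ k ∈ Finset.range n, ((if k ∈ s then 1 else -1) * β k) * V k ω) ∂P := by
        simp only [← mul_assoc]
        exact integral_finsetSum _ fun s _ => hV.integrable_exp_sum n _
    _ ≤ ∑ s ∈ (Finset.range n).powerset, exp ((∑ i ∈ Finset.range n, ∑ j ∈ Finset.range n,
          β i * β j * fBmCov H Δt i j) / 2) := by
        refine Finset.sum_le_sum fun s _ => ?_
        rw [hV.integral_exp_sum, Real.coe_toNNReal']
        gcongr
        refine max_le (Finset.sum_le_sum fun i _ => Finset.sum_le_sum fun j _ => ?_)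
          (Finset.sum_nonneg fun i _ => Finset.sum_nonneg fun j _ => hnn i j)
        have := hnn i j
        split_ifs <;> linarith
    _ = _ := by simp

end IsfBmIncrements

theorem tendsto_prod_mul_exp_rpow {u : ℕ → ℝ} {q K η : ℝ} (hu : ∀ n, 0 ≤ u n)
    (hq0 : 0 < q) (hq1 : q < 1) (huq : ∀ᶠ n in atTop, u n ≤ q) (hη0 : 0 < η) (hη1 : η < 1) :
    Tendsto (fun n : ℕ => (∏ k ∈ Finset.range n, u k) * exp (K * (n : ℝ) ^ (1 - η)))
      atTop (nhds 0) := by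
  obtain ⟨N, hN⟩ := eventually_atTop.1 huq
  have hprod : ∀ n, 0 ≤ ∏ k ∈ Finset.range n, u k := fun n => Finset.prod_nonneg fun k _ => hu k
  have hlog := log_neg hq0 hq1
  have hlim : Tendsto (fun n : ℕ => exp ((n : ℝ) ^ (1 - η) * (K + (n : ℝ) ^ η * log q)))
      atTop (nhds 0) := by
    refine tendsto_exp_atBot.comp (Tendsto.atTop_mul_atBot₀ ?_ ?_)
    · exact (tendsto_rpow_atTop (by linarith)).comp tendsto_natCast_atTop_atTop
    · exact tendsto_atBot_add_const_left _ _
        (((tendsto_rpow_atTop hη0).comp tendsto_natCast_atTop_atTop).atTop_mul_const_of_neg hlog)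
  have hlim' := hlim.const_mul ((∏ k ∈ Finset.range N, u k) / q ^ N)
  rw [mul_zero] at hlim'
  refine squeeze_zero' (Eventually.of_forall fun n => mul_nonneg (hprod n) (exp_pos _).le) ?_ hlim'
  filter_upwards [eventually_ge_atTop N, eventually_gt_atTop 0] with n hn hn0
  obtain ⟨m, rfl⟩ := Nat.exists_eq_add_of_le hn
  have hgeom : ∏ k ∈ Finset.range (N + m), u k ≤ q ^ m * ∏ k ∈ Finset.range N, u k := by
    refine le_geom (u := fun m => ∏ k ∈ Finset.range (N + m), u k) hq0.le m fun k _ => ?_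
    rw [← add_assoc, Finset.prod_range_succ, mul_comm]
    exact mul_le_mul_of_nonneg_right (hN _ (by omega)) (hprod _)
  have hpos : (0 : ℝ) < ((N + m : ℕ) : ℝ) := by exact_mod_cast hn0
  have hexp : exp (((N + m : ℕ) : ℝ) ^ (1 - η) * (K + ((N + m : ℕ) : ℝ) ^ η * log q))
      = q ^ (N + m) * exp (K * ((N + m : ℕ) : ℝ) ^ (1 - η)) := by
    rw [mul_add, ← mul_assoc, ← rpow_add hpos, sub_add_cancel, rpow_one, exp_add,
      ← log_pow, exp_log (pow_pos hq0 _)]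
    ring_nf
  rw [hexp, ← mul_assoc]
  gcongr
  refine hgeom.trans (le_of_eq ?_)
  rw [pow_add]
  field_simp

/-- A process dominated by a product of exponentials of fractional Brownian increments, with
eventually small prefactors and weights decaying like `k ^ (1 - 2 * H)`, tends to zero in mean
square. -/
theorem IsfBmIncrements.tendsto_integral_sq {Ω : Type*} [MeasurableSpace Ω] {P : Measure Ω}
    {H Δt : ℝ} {V : ℕ → Ω → ℝ} (hV : IsfBmIncrements P H Δt V)
    (hH : H ∈ Set.Ioo (1 / 2 : ℝ) 1) (hΔt : 0 ≤ Δt) {A β : ℕ → ℝ} {B : ℝ}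
    (hA0 : ∀ k, 0 ≤ A k) (hA : ∀ᶠ k in atTop, A k ≤ 1 / 2) (hβ0 : ∀ k, 0 ≤ β k)
    (hβ : ∀ k : ℕ, β k ≤ B * ((k : ℝ) + 1) ^ (-(2 * H - 1))) {Y : ℕ → Ω → ℝ}
    (hY : ∀ᵐ ω ∂P, ∀ n, |Y (n + 1) ω| ≤
      ∏ k ∈ Finset.range (n + 1), A k * exp (β k * |V k ω|)) :
    Tendsto (fun n => ∫ ω, (Y n ω) ^ 2 ∂P) atTop (nhds 0) := by
  have hβ2 : ∀ k, 0 ≤ 2 * β k := fun k => by linarith [hβ0 k]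
  obtain ⟨K, η, hη0, hη1, hK⟩ := exists_weighted_fBmCov_sum_le (B := 2 * B) hH hΔt hβ2
    fun k => by linarith [hβ k]
  have hlim := tendsto_prod_mul_exp_rpow (u := fun k => 2 * A k ^ 2) (q := 1 / 2) (K := K / 2)
    (fun k => by positivity) (by norm_num) (by norm_num)
    (by filter_upwards [hA] with k hk; nlinarith [hA0 k]) hη0 hη1
  refine squeeze_zero' (Eventually.of_forall fun n => integral_nonneg fun ω => sq_nonneg _) ?_ hlim
  filter_upwards [eventually_gt_atTop 0] with n hn
  obtain ⟨m, rfl⟩ := Nat.exists_eq_add_of_lt hn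
  rw [zero_add]
  have hint := (hV.integrable_prod_exp_abs (fun k => 2 * β k) (m + 1)).const_mul
    (∏ k ∈ Finset.range (m + 1), A k ^ 2)
  calc ∫ ω, (Y (m + 1) ω) ^ 2 ∂P
      ≤ ∫ ω, (∏ k ∈ Finset.range (m + 1), A k ^ 2) *
          ∏ k ∈ Finset.range (m + 1), exp |2 * β k * V k ω| ∂P := by
        refine integral_mono_of_nonneg (ae_of_all _ fun ω => sq_nonneg _) hint ?_
        filter_upwards [hY] with ω hω
        have h := pow_le_pow_left₀ (abs_nonneg _) (hω m) 2
        rw [sq_abs] at h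
        refine h.trans (le_of_eq ?_)
        rw [← Finset.prod_pow, ← Finset.prod_mul_distrib]
        refine Finset.prod_congr rfl fun k _ => ?_
        rw [mul_pow, ← exp_nat_mul, abs_mul, abs_of_nonneg (hβ2 k)]
        push_cast
        ring_nf
    _ = (∏ k ∈ Finset.range (m + 1), A k ^ 2) *
          ∫ ω, ∏ k ∈ Finset.range (m + 1), exp |2 * β k * V k ω| ∂P := integral_const_mul _ _
    _ ≤ (∏ k ∈ Finset.range (m + 1), A k ^ 2) *
          (2 ^ (m + 1) * exp (K / 2 * ((m + 1 : ℕ) : ℝ) ^ (1 - η))) := by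
        refine mul_le_mul_of_nonneg_left ?_ (Finset.prod_nonneg fun k _ => sq_nonneg _)
        refine (hV.integral_prod_exp_abs_le hH.1.le hΔt hβ2 (m + 1)).trans ?_
        gcongr
        linarith [hK (m + 1)]
    _ = _ := by
        rw [Finset.prod_mul_distrib, Finset.prod_const, Finset.card_range]
        ring

/-! ### One step of the stochastic theta method -/

theorem mul_abs_le_abs_sub_of_mul_le {x y s : ℝ} (hxy : x * y ≤ -s * x ^ 2) :
    (1 + s) * |x| ≤ |x - y| := by
  rcases eq_or_ne x 0 with rfl | hx
  · simp
  · have hpos := abs_pos.2 hx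
    refine le_of_mul_le_mul_left ?_ hpos
    calc |x| * ((1 + s) * |x|) = (1 + s) * x ^ 2 := by rw [← sq_abs x]; ring
      _ ≤ x * (x - y) := by linarith
      _ ≤ |x| * |x - y| := by rw [← abs_mul]; exact le_abs_self _

theorem ratio_le_half_of_theta_large {lam lamBar θ : ℝ} (hlam : 0 < lam) (hlamBar : lam ≤ lamBar)
    (hθ : √6 * exp 1 * (lamBar / lam) / (√6 * exp 1 * (lamBar / lam) + 1) ≤ θ) (hθ1 : θ < 1) :
    0 < θ ∧ 2 * ((1 - θ) * lamBar) < θ * lam := by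
  have h2 : (2 : ℝ) < √6 := by
    rw [Real.lt_sqrt (by norm_num)]; norm_num
  have he : (1 : ℝ) < exp 1 := by simp
  have hr : 0 < lamBar / lam := div_pos (by linarith) hlam
  have hx : 2 * (lamBar / lam) < √6 * exp 1 * (lamBar / lam) := by
    gcongr
    nlinarith
  set x := √6 * exp 1 * (lamBar / lam)
  have hx0 : 0 < x := by linarith
  have hθ0 : 0 < θ := lt_of_lt_of_le (by positivity) hθ
  rw [div_le_iff₀ (by linarith)] at hθ
  refine ⟨hθ0, ?_⟩
  have h3 : 2 * (lamBar / lam) * (1 - θ) < θ := by nlinarith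
  have h4 : 2 * (lamBar / lam) * (1 - θ) = 2 * ((1 - θ) * lamBar) / lam := by ring
  rwa [h4, div_lt_iff₀ hlam] at h3

/-- Part (ii) of Theorem 1.5: mean square stability of the stochastic theta method
for nonlinear SDEs driven by fBm when
`(√6·e·(λ̄/λ))/(√6·e·(λ̄/λ) + 1) ≤ θ < 1`. -/
theorem stm_fBm_nonlinear_meanSquareStable_largeTheta
    {Ω : Type*} [MeasurableSpace Ω] (P : Measure Ω) [IsProbabilityMeasure P]
    (H Δt κ lam lamBar μ θ : ℝ)
    (hH : H ∈ Set.Ioo (1 / 2 : ℝ) 1) (hΔt : 0 < Δt) (hκ : 2 * H ≤ κ)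
    (hlam : 0 < lam) (hlamBar : lam ≤ lamBar) (hμ : 0 < μ)
    (hC : (2 * H < κ ∧ 0 < lam) ∨ (κ = 2 * H ∧ -lam + μ ^ 2 < 0))
    (hθ : θ ∈ Set.Ico (Real.sqrt 6 * Real.exp 1 * (lamBar / lam)
        / (Real.sqrt 6 * Real.exp 1 * (lamBar / lam) + 1)) 1)
    (f g : ℝ → ℝ → ℝ)
    (hmono : ∀ t > (0 : ℝ), ∀ x : ℝ, x * f t x ≤ -lam * κ * t ^ (κ - 1) * x ^ 2)
    (hf : ∀ t > (0 : ℝ), ∀ x : ℝ, |f t x| ≤ lamBar * κ * t ^ (κ - 1) * |x|)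
    (hg : ∀ t > (0 : ℝ), ∀ x : ℝ, |g t x| ≤ μ * |x|)
    (V : ℕ → Ω → ℝ) (hV : IsfBmIncrements P H Δt V)
    (X₀ : ℝ) (hX₀ : X₀ ≠ 0) (X : ℕ → Ω → ℝ)
    (hXmeas : ∀ n, Measurable (X n))
    (hXzero : ∀ ω, X 0 ω = X₀)
    (hXrec : ∀ᵐ ω ∂P, ∀ n : ℕ, X (n + 1) ω
      = X n ω + θ * f ((n + 1 : ℕ) * Δt) (X (n + 1) ω) * Δt
        + (1 - θ) * f ((n : ℕ) * Δt) (X n ω) * Δt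
        + g ((n : ℕ) * Δt) (X n ω) * V n ω) :
    Tendsto (fun n => ∫ ω, (X n ω) ^ 2 ∂P) atTop (nhds 0) := by
  obtain ⟨hH0, hH1⟩ := hH
  obtain ⟨hθ0, hratio⟩ := ratio_le_half_of_theta_large hlam hlamBar hθ.1 hθ.2
  have hθ1 : 0 < 1 - θ := by linarith [hθ.2]
  have hlamBar0 : 0 < lamBar := by linarith
  have hκ1 : 0 < κ - 1 := by linarith
  have hκ0 : 0 < κ := by linarith
  set R := (1 - θ) * lamBar / (θ * lam) with hR
  have hR0 : 0 < R := by positivity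
  have hR2 : R < 1 / 2 := by
    rw [hR, div_lt_iff₀ (by positivity)]; linarith
  set s : ℕ → ℝ := fun k => θ * lam * κ * ((k : ℝ) * Δt) ^ (κ - 1) * Δt with hs
  have hs0 : ∀ k, 0 ≤ s k := fun k => by positivity
  have hsmono : ∀ k, s k ≤ s (k + 1) := fun k => by
    simp only [hs]
    gcongr
    simp
  have hslim : Tendsto (fun k => s (k + 1)) atTop atTop := by
    refine (tendsto_add_atTop_iff_nat 1).2 (Tendsto.atTop_mul_const hΔt
      (Tendsto.const_mul_atTop (by positivity) ((tendsto_rpow_atTop hκ1).comp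
        (tendsto_natCast_atTop_atTop.atTop_mul_const hΔt))))
  set c := θ * lam * κ * Δt ^ (κ - 1) * Δt with hc
  have hc0 : 0 < c := by positivity
  have hsc : ∀ k : ℕ, c * ((k : ℝ) + 1) ^ (2 * H - 1) ≤ s (k + 1) := fun k => by
    have h1 : ((k : ℝ) + 1) ^ (2 * H - 1) ≤ ((k : ℝ) + 1) ^ (κ - 1) :=
      rpow_le_rpow_of_exponent_le (by linarith [k.cast_nonneg (α := ℝ)]) (by linarith)
    have h2 : s (k + 1) = c * ((k : ℝ) + 1) ^ (κ - 1) := by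
      simp only [hs, hc]
      push_cast
      rw [mul_rpow (by positivity) hΔt.le]
      ring
    rw [h2]
    gcongr
  set D := |X₀ + (1 - θ) * f 0 X₀ * Δt| + |g 0 X₀| with hD
  have hD0 : 0 ≤ D := by positivity
  let A : ℕ → ℝ := fun k => if k = 0 then D else R + 1 / (1 + s (k + 1))
  let β : ℕ → ℝ := fun k => if k = 0 then 1 else μ / R / (1 + s (k + 1))
  have hA0 : ∀ k, 0 ≤ A k := fun k => by
    have := hs0 (k + 1)
    simp only [A]
    split_ifs <;> positivity
  have hβ0 : ∀ k, 0 ≤ β k := fun k => by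
    have := hs0 (k + 1)
    simp only [β]
    split_ifs <;> positivity
  have hA : ∀ᶠ k in atTop, A k ≤ 1 / 2 := by
    have hlim : Tendsto (fun k => R + 1 / (1 + s (k + 1))) atTop (nhds (R + 0)) :=
      tendsto_const_nhds.add
        (tendsto_const_nhds.div_atTop (tendsto_atTop_add_const_left _ _ hslim))
    rw [add_zero] at hlim
    filter_upwards [hlim.eventually_le_const hR2, eventually_gt_atTop 0] with k hk hk0
    simpa only [A, if_neg hk0.ne'] using hk
  have hβ : ∀ k : ℕ, β k ≤ (1 + μ / R / c) * ((k : ℝ) + 1) ^ (-(2 * H - 1)) := fun k => by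
    have hk : (0 : ℝ) < (k : ℝ) + 1 := by positivity
    have hB : 0 < μ / R / c := by positivity
    rcases eq_or_ne k 0 with rfl | hk0
    · simpa [β] using hB.le
    · have hp : 0 < ((k : ℝ) + 1) ^ (2 * H - 1) := by positivity
      simp only [β, if_neg hk0]
      rw [rpow_neg hk.le]
      calc μ / R / (1 + s (k + 1)) ≤ μ / R / (c * ((k : ℝ) + 1) ^ (2 * H - 1)) := by
            gcongr
            linarith [hsc k]
        _ = μ / R / c * (((k : ℝ) + 1) ^ (2 * H - 1))⁻¹ := by
            rw [← div_div, div_eq_mul_inv (μ / R / c)]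
        _ ≤ _ := by gcongr; linarith
  refine hV.tendsto_integral_sq ⟨hH0, hH1⟩ hΔt.le hA0 hA hβ0 hβ ?_
  filter_upwards [hXrec] with ω hω n
  have hleft : ∀ k : ℕ, (1 + s (k + 1)) * |X (k + 1) ω| ≤
      |X (k + 1) ω - θ * f ((k + 1 : ℕ) * Δt) (X (k + 1) ω) * Δt| := fun k => by
    refine mul_abs_le_abs_sub_of_mul_le ?_
    have h := hmono ((k + 1 : ℕ) * Δt) (by positivity) (X (k + 1) ω)
    have h' := mul_le_mul_of_nonneg_left h (by positivity : 0 ≤ θ * Δt)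
    simp only [hs]
    linarith
  induction n with
  | zero =>
    have h2 : |X 1 ω| ≤ (1 + s 1) * |X 1 ω| := by
      nlinarith [hs0 1, abs_nonneg (X 1 ω)]
    have h3 := hω 0
    have h4 : X 1 ω - θ * f ((0 + 1 : ℕ) * Δt) (X 1 ω) * Δt =
        (X₀ + (1 - θ) * f 0 X₀ * Δt) + g 0 X₀ * V 0 ω := by
      rw [hXzero] at h3
      simp only [Nat.cast_zero, zero_mul] at h3
      linarith
    have h5 := hleft 0
    rw [zero_add] at h4 h5
    rw [h4] at h5
    have h6 := abs_add_le (X₀ + (1 - θ) * f 0 X₀ * Δt) (g 0 X₀ * V 0 ω)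
    rw [abs_mul] at h6
    have h7 := add_one_le_exp |V 0 ω|
    have h8 := mul_le_mul_of_nonneg_left h7 hD0
    simp only [zero_add, Finset.prod_range_one, A, β, if_true, one_mul]
    nlinarith [abs_nonneg (X₀ + (1 - θ) * f 0 X₀ * Δt), abs_nonneg (g 0 X₀),
      abs_nonneg (V 0 ω),
      mul_nonneg (abs_nonneg (X₀ + (1 - θ) * f 0 X₀ * Δt)) (abs_nonneg (V 0 ω))]
  | succ n ih =>
    rw [Finset.prod_range_succ]
    have ht : (0 : ℝ) < ((n + 1 : ℕ) : ℝ) * Δt := by positivity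
    have hf' := hf _ ht (X (n + 1) ω)
    have hg' := hg _ ht (X (n + 1) ω)
    have hdrift : |(1 - θ) * f ((n + 1 : ℕ) * Δt) (X (n + 1) ω) * Δt| ≤
        R * s (n + 1 + 1) * |X (n + 1) ω| := by
      rw [abs_mul, abs_mul, abs_of_pos hθ1, abs_of_pos hΔt]
      calc (1 - θ) * |f ((n + 1 : ℕ) * Δt) (X (n + 1) ω)| * Δt
          ≤ (1 - θ) * (lamBar * κ * (((n + 1 : ℕ) : ℝ) * Δt) ^ (κ - 1) * |X (n + 1) ω|) * Δt := by
            gcongr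
        _ = R * s (n + 1) * |X (n + 1) ω| := by
            simp only [hR, hs]
            field_simp
        _ ≤ _ := by
            gcongr
            exact hsmono (n + 1)
    have hdiff : |g ((n + 1 : ℕ) * Δt) (X (n + 1) ω) * V (n + 1) ω| ≤
        μ * |V (n + 1) ω| * |X (n + 1) ω| := by
      rw [abs_mul]
      calc _ ≤ μ * |X (n + 1) ω| * |V (n + 1) ω| := by gcongr
        _ = _ := by ring
    have hstep : (1 + s (n + 1 + 1)) * |X (n + 1 + 1) ω| ≤
        (1 + R * s (n + 1 + 1) + μ * |V (n + 1) ω|) * |X (n + 1) ω| := by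
      refine (hleft (n + 1)).trans ?_
      have heq : X (n + 1 + 1) ω - θ * f ((n + 1 + 1 : ℕ) * Δt) (X (n + 1 + 1) ω) * Δt =
          X (n + 1) ω + (1 - θ) * f ((n + 1 : ℕ) * Δt) (X (n + 1) ω) * Δt
            + g ((n + 1 : ℕ) * Δt) (X (n + 1) ω) * V (n + 1) ω := by
        linarith [hω (n + 1)]
      rw [heq]
      refine (abs_add_three _ _ _).trans ?_
      linarith
    have hpos : 0 < 1 + s (n + 1 + 1) := by linarith [hs0 (n + 1 + 1)]
    have hfactor : (1 + R * s (n + 1 + 1) + μ * |V (n + 1) ω|) ≤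
        (1 + s (n + 1 + 1)) * (A (n + 1) * exp (β (n + 1) * |V (n + 1) ω|)) := by
      have hAval : A (n + 1) = R + 1 / (1 + s (n + 1 + 1)) := by simp [A]
      have hAβ : μ / (1 + s (n + 1 + 1)) ≤ A (n + 1) * β (n + 1) := by
        have : R * β (n + 1) = μ / (1 + s (n + 1 + 1)) := by
          simp only [β, Nat.succ_ne_zero, if_false]
          field_simp
        rw [← this, hAval]
        exact mul_le_mul_of_nonneg_right (by linarith [one_div_pos.2 hpos]) (hβ0 _)
      rw [div_le_iff₀ hpos] at hAβ
      have hexp := mul_le_mul_of_nonneg_left (add_one_le_exp (β (n + 1) * |V (n + 1) ω|))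
        (mul_nonneg hpos.le (hA0 (n + 1)))
      have hbase : 1 + R * s (n + 1 + 1) ≤ (1 + s (n + 1 + 1)) * A (n + 1) := by
        rw [hAval, mul_add, mul_one_div_cancel hpos.ne']
        linarith
      have := mul_le_mul_of_nonneg_right hAβ (abs_nonneg (V (n + 1) ω))
      linarith
    refine le_of_mul_le_mul_left ?_ hpos
    calc _ ≤ _ := hstep
      _ ≤ (1 + s (n + 1 + 1)) * (A (n + 1) * exp (β (n + 1) * |V (n + 1) ω|)) *
          ∏ k ∈ Finset.range (n + 1), A k * exp (β k * |V k ω|) :=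
        mul_le_mul hfactor ih (abs_nonneg _)
          (mul_nonneg hpos.le (mul_nonneg (hA0 _) (exp_pos _).le))
      _ = _ := by ring
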